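/- Assume the coercivity condition (C), the monotonicity assumption (M) and assumption (E). For λ > 0 let v^λ = (v^λ_i)_{i∈𝕀} be the unique viscosity solution of (P_λ). Then there exists a viscosity solution v⁰ = (v⁰_i)_{i∈𝕀} of (P_0) such that for every i ∈ 𝕀 the functions v^λ_i converge to v⁰_i uniformly on 𝕋ⁿ as λ → 0+. -/

import Mathlib

open MeasureTheory Filter Topology RealInnerProductSpace

noncomputable section

/-- Euclidean space ℝⁿ, the universal cover of the flat torus 𝕋ⁿ = ℝⁿ/ℤⁿ. -/
abbrev Euc (n : ℕ) := EuclideanSpace ℝ (Fin n)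

/-- A vector of ℝⁿ with integer coordinates (an element of ℤⁿ). -/
def IsIntVec {n : ℕ} (z : Euc n) : Prop := ∀ i, ∃ k : ℤ, z i = (k : ℝ)

/-- ℤⁿ-periodic functions on ℝⁿ: these represent functions on the torus 𝕋ⁿ. -/
def TorusFun {n : ℕ} {α : Type*} (f : Euc n → α) : Prop :=
  ∀ (x z : Euc n), IsIntVec z → f (x + z) = f x

/-- Functions on 𝕋ⁿ × Ξ, i.e. ℤⁿ-periodic in the first variable. -/
def TorusFun2 {n : ℕ} {Ξ : Type*} {α : Type*} (f : Euc n × Ξ → α) : Prop :=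
  ∀ (x z : Euc n) (ξ : Ξ), IsIntVec z → f (x + z, ξ) = f (x, ξ)

/-- The Hamiltonian H_{φ,i}(x,p) = sup_{ξ∈Ξ} (−g_i(x,ξ)·p − φ_i(x,ξ)). -/
def ham {n m : ℕ} {Ξ : Type*} (g : Fin m → Euc n × Ξ → Euc n)
    (φ : Fin m → Euc n × Ξ → ℝ) (i : Fin m) (x p : Euc n) : ℝ :=
  ⨆ ξ : Ξ, (-⟪g i (x, ξ), p⟫ - φ i (x, ξ))

/-- The data g = (g_i), L = (L_i) consist of continuous functions on 𝕋ⁿ × Ξ. -/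
def GoodData {n m : ℕ} {Ξ : Type*} [TopologicalSpace Ξ]
    (g : Fin m → Euc n × Ξ → Euc n) (L : Fin m → Euc n × Ξ → ℝ) : Prop :=
  (∀ i, Continuous (g i) ∧ TorusFun2 (g i)) ∧ (∀ i, Continuous (L i) ∧ TorusFun2 (L i))

/-- Coercivity (C): min_{x∈𝕋ⁿ} H_i(x,p) → ∞ as |p| → ∞. -/
def Coercive {n m : ℕ} {Ξ : Type*} (g : Fin m → Euc n × Ξ → Euc n)
    (L : Fin m → Euc n × Ξ → ℝ) : Prop :=
  ∀ (i : Fin m) (M : ℝ), ∃ R : ℝ, ∀ p : Euc n, R ≤ ‖p‖ → ∀ x : Euc n, M ≤ ham g L i x p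

/-- A monotone m×m real matrix. -/
def IsMonotoneMat {m : ℕ} (B : Matrix (Fin m) (Fin m) ℝ) : Prop :=
  ∀ (u : Fin m → ℝ) (k : Fin m), (∀ i, u i ≤ u k) → 0 ≤ u k → 0 ≤ ∑ j, B k j * u j

/-- Assumption (M): B(x) has continuous entries (as functions on 𝕋ⁿ) and is monotone
for every x. -/
def GoodCoupling {n m : ℕ} (B : Euc n → Matrix (Fin m) (Fin m) ℝ) : Prop :=
  (∀ i j, Continuous (fun x => B x i j) ∧ TorusFun (fun x => B x i j)) ∧
    ∀ x, IsMonotoneMat (B x)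

/-- Viscosity subsolution of λu + Bu + H_φ[u] = c in 𝕋ⁿ. -/
def IsSubsol {n m : ℕ} {Ξ : Type*} (B : Euc n → Matrix (Fin m) (Fin m) ℝ) (lam : ℝ)
    (g : Fin m → Euc n × Ξ → Euc n) (φ : Fin m → Euc n × Ξ → ℝ)
    (c : Fin m → ℝ) (u : Fin m → Euc n → ℝ) : Prop :=
  (∀ i, UpperSemicontinuous (u i) ∧ TorusFun (u i)) ∧
    ∀ (i : Fin m) (ψ : Euc n → ℝ), ContDiff ℝ 1 ψ → TorusFun ψ →
      ∀ x : Euc n, IsLocalMax (fun y => u i y - ψ y) x →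
        lam * u i x + (∑ j, B x i j * u j x) + ham g φ i x (gradient ψ x) ≤ c i

/-- Viscosity supersolution of λu + Bu + H_φ[u] = c in 𝕋ⁿ. -/
def IsSupersol {n m : ℕ} {Ξ : Type*} (B : Euc n → Matrix (Fin m) (Fin m) ℝ) (lam : ℝ)
    (g : Fin m → Euc n × Ξ → Euc n) (φ : Fin m → Euc n × Ξ → ℝ)
    (c : Fin m → ℝ) (u : Fin m → Euc n → ℝ) : Prop :=
  (∀ i, LowerSemicontinuous (u i) ∧ TorusFun (u i)) ∧
    ∀ (i : Fin m) (ψ : Euc n → ℝ), ContDiff ℝ 1 ψ → TorusFun ψ →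
      ∀ x : Euc n, IsLocalMin (fun y => u i y - ψ y) x →
        c i ≤ lam * u i x + (∑ j, B x i j * u j x) + ham g φ i x (gradient ψ x)

/-- Viscosity solution of λu + Bu + H_φ[u] = c in 𝕋ⁿ. -/
def IsSol {n m : ℕ} {Ξ : Type*} (B : Euc n → Matrix (Fin m) (Fin m) ℝ) (lam : ℝ)
    (g : Fin m → Euc n × Ξ → Euc n) (φ : Fin m → Euc n × Ξ → ℝ)
    (c : Fin m → ℝ) (u : Fin m → Euc n → ℝ) : Prop :=
  (∀ i, Continuous (u i)) ∧ IsSubsol B lam g φ c u ∧ IsSupersol B lam g φ c u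

/-- (φ,u) ∈ F(λ): φ ∈ C(𝕋ⁿ×Ξ)ᵐ, u ∈ C(𝕋ⁿ)ᵐ and u is a viscosity subsolution of
B^λ u + H_φ[u] = 0 in 𝕋ⁿ. -/
def memF {n m : ℕ} {Ξ : Type*} [TopologicalSpace Ξ]
    (B : Euc n → Matrix (Fin m) (Fin m) ℝ) (lam : ℝ)
    (g : Fin m → Euc n × Ξ → Euc n)
    (φ : Fin m → Euc n × Ξ → ℝ) (u : Fin m → Euc n → ℝ) : Prop :=
  (∀ i, Continuous (φ i) ∧ TorusFun2 (φ i)) ∧ (∀ i, Continuous (u i)) ∧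
    IsSubsol B lam g φ (fun _ => 0) u

/-- ρ_i(x) = Σ_j b_{ij}(x). -/
def rhoB {n m : ℕ} (B : Euc n → Matrix (Fin m) (Fin m) ℝ) (i : Fin m) (x : Euc n) : ℝ :=
  ∑ j, B x i j

/-- ν ∈ P_{B^λ}: a family of finite nonnegative Borel measures with ⟨ν, B^λ1⟩ = 1. -/
def memPB {n m : ℕ} {Ξ : Type*} [MeasurableSpace Ξ]
    (B : Euc n → Matrix (Fin m) (Fin m) ℝ) (lam : ℝ)
    (ν : Fin m → Measure (Euc n × Ξ)) : Prop :=
  (∀ i, IsFiniteMeasure (ν i)) ∧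
    (∑ i, ∫ q, (lam + rhoB B i q.1) ∂(ν i)) = 1

/-- ν ∈ G'(z,k,λ): ν ∈ P_{B^λ} and ⟨ν, φ − u_k(z) B^λ1⟩ ≥ 0 for every (φ,u) ∈ F(λ). -/
def memGP {n m : ℕ} {Ξ : Type*} [TopologicalSpace Ξ] [MeasurableSpace Ξ]
    (B : Euc n → Matrix (Fin m) (Fin m) ℝ) (lam : ℝ)
    (g : Fin m → Euc n × Ξ → Euc n) (z : Euc n) (k : Fin m)
    (ν : Fin m → Measure (Euc n × Ξ)) : Prop :=
  memPB B lam ν ∧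
    ∀ φ u, memF B lam g φ u →
      0 ≤ ∑ i, ∫ q, (φ i q - u k z * (lam + rhoB B i q.1)) ∂(ν i)

/-- μ ∈ P: a family of nonnegative Borel measures of total mass 1. -/
def memP {n m : ℕ} {Ξ : Type*} [MeasurableSpace Ξ]
    (μ : Fin m → Measure (Euc n × Ξ)) : Prop :=
  (∀ i, IsFiniteMeasure (μ i)) ∧ (∑ i, (μ i Set.univ).toReal) = 1

/-- μ ∈ P(z,k,λ): μ ∈ P and Σ_i ⟨μ_i, (λ+ρ_i)⁻¹ φ_i⟩ ≥ u_k(z) for all (φ,u) ∈ F(λ). -/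
def memPzk {n m : ℕ} {Ξ : Type*} [TopologicalSpace Ξ] [MeasurableSpace Ξ]
    (B : Euc n → Matrix (Fin m) (Fin m) ℝ) (lam : ℝ)
    (g : Fin m → Euc n × Ξ → Euc n) (z : Euc n) (k : Fin m)
    (μ : Fin m → Measure (Euc n × Ξ)) : Prop :=
  memP μ ∧
    ∀ φ u, memF B lam g φ u →
      u k z ≤ ∑ i, ∫ q, (lam + rhoB B i q.1)⁻¹ * φ i q ∂(μ i)

/-- μ ∈ P(0): μ ∈ P and ⟨μ,φ⟩ ≥ 0 for all (φ,u) ∈ F(0). -/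
def memP0 {n m : ℕ} {Ξ : Type*} [TopologicalSpace Ξ] [MeasurableSpace Ξ]
    (B : Euc n → Matrix (Fin m) (Fin m) ℝ)
    (g : Fin m → Euc n × Ξ → Euc n)
    (μ : Fin m → Measure (Euc n × Ξ)) : Prop :=
  memP μ ∧ ∀ φ u, memF B 0 g φ u → 0 ≤ ∑ i, ∫ q, φ i q ∂(μ i)

/-- μ ∈ M₊(0): a family of finite nonnegative Borel measures with ⟨μ,φ⟩ ≥ 0 for all
(φ,u) ∈ F(0). -/
def memM0 {n m : ℕ} {Ξ : Type*} [TopologicalSpace Ξ] [MeasurableSpace Ξ]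
    (B : Euc n → Matrix (Fin m) (Fin m) ℝ)
    (g : Fin m → Euc n × Ξ → Euc n)
    (μ : Fin m → Measure (Euc n × Ξ)) : Prop :=
  (∀ i, IsFiniteMeasure (μ i)) ∧ ∀ φ u, memF B 0 g φ u → 0 ≤ ∑ i, ∫ q, φ i q ∂(μ i)

/-- Assumption (E): problem (P₀) has a Lipschitz continuous viscosity solution. -/
def AssumptionE {n m : ℕ} {Ξ : Type*} (B : Euc n → Matrix (Fin m) (Fin m) ℝ)
    (g : Fin m → Euc n × Ξ → Euc n) (L : Fin m → Euc n × Ξ → ℝ) : Prop :=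
  ∃ v₀ : Fin m → Euc n → ℝ, (∀ i, ∃ K : NNReal, LipschitzWith K (v₀ i)) ∧
    IsSol B 0 g L (fun _ => 0) v₀

end


section aux

set_option linter.unusedSectionVars false

variable {n m : ℕ}

lemma IsIntVec.neg' {z : Euc n} (h : IsIntVec z) : IsIntVec (-z) := by
  intro i; obtain ⟨k, hk⟩ := h i; exact ⟨-k, by simp [hk]⟩

/-- The unit cube. -/
def cube (n : ℕ) : Set (Euc n) := {x | ∀ i, x i ∈ Set.Icc (0:ℝ) 1}

lemma cube_compact (n : ℕ) : IsCompact (cube n) := by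
  have h : cube n = (WithLp.toLp 2) '' (Set.univ.pi fun _ : Fin n => Set.Icc (0:ℝ) 1) := by
    ext x
    constructor
    · intro hx
      exact ⟨WithLp.ofLp x, fun i _ => hx i, rfl⟩
    · rintro ⟨y, hy, rfl⟩ i
      exact hy i (Set.mem_univ i)
  rw [h]
  exact (isCompact_univ_pi fun _ => isCompact_Icc).image (PiLp.continuous_toLp 2 _)

lemma cube_zero (n : ℕ) : (0 : Euc n) ∈ cube n := by
  intro i; simp

lemma exists_rep (x : Euc n) : ∃ z : Euc n, IsIntVec z ∧ x + z ∈ cube n := by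
  refine ⟨WithLp.toLp 2 (fun i => -((⌊x i⌋ : ℤ) : ℝ)), fun i => ⟨-⌊x i⌋, by simp⟩, fun i => ?_⟩
  have h1 := Int.floor_le (x i)
  have h2 := Int.lt_floor_add_one (x i)
  simp only [PiLp.add_apply, Set.mem_Icc]
  constructor <;> linarith

lemma exists_rep_eq (x : Euc n) : ∃ y ∈ cube n, ∀ {α : Type} (f : Euc n → α), TorusFun f → f x = f y := by
  obtain ⟨z, hz, hy⟩ := exists_rep x
  exact ⟨x + z, hy, fun f hf => (hf x z hz).symm⟩

lemma torus_eq {α : Type*} {f : Euc n → α} (hf : TorusFun f) {x y : Euc n} (h : IsIntVec (x - y)) :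
    f x = f y := by
  have := hf y (x - y) h
  simpa using this

lemma torus_bdd {f : Euc n → ℝ} (hf : TorusFun f) (hc : Continuous f) : ∃ C, ∀ x, |f x| ≤ C := by
  obtain ⟨C, hC⟩ := (cube_compact n).exists_bound_of_continuousOn hc.continuousOn
  refine ⟨C, fun x => ?_⟩
  obtain ⟨y, hy, h⟩ := exists_rep_eq x
  rw [h f hf]
  exact hC y hy

/-- The periodic penalization. -/
noncomputable def Phi (d : Euc n) : ℝ := ∑ i, Real.sin (Real.pi * d i) ^ 2

/-- Its gradient. -/
noncomputable def GPhi (d : Euc n) : Euc n :=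
  WithLp.toLp 2 (fun i => 2 * Real.pi * Real.sin (Real.pi * d i) * Real.cos (Real.pi * d i))

lemma Phi_nonneg (d : Euc n) : 0 ≤ Phi d := Finset.sum_nonneg fun _ _ => sq_nonneg _

lemma Phi_zero : Phi (0 : Euc n) = 0 := by simp [Phi]

lemma Phi_contDiff : ContDiff ℝ 1 (Phi : Euc n → ℝ) := by
  unfold Phi
  fun_prop

lemma Phi_cont : Continuous (Phi : Euc n → ℝ) := Phi_contDiff.continuous

lemma Phi_torus : TorusFun (Phi : Euc n → ℝ) := by
  intro x z hz
  unfold Phi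
  refine Finset.sum_congr rfl fun i _ => ?_
  obtain ⟨k, hk⟩ := hz i
  have : Real.pi * (x + z) i = Real.pi * x i + k * Real.pi := by
    simp [hk]; ring
  rw [this, Real.sin_add_int_mul_pi, mul_pow]
  have : ((-1 : ℝ) ^ k) ^ 2 = 1 := by
    rw [← zpow_natCast, ← zpow_mul, mul_comm, zpow_mul]; simp
  rw [this, one_mul]

lemma Phi_eq_zero {d : Euc n} (h : Phi d ≤ 0) : IsIntVec d := by
  have h0 : Phi d = 0 := le_antisymm h (Phi_nonneg d)
  intro i
  have := (Finset.sum_eq_zero_iff_of_nonneg (fun i _ => sq_nonneg (Real.sin (Real.pi * d i)))).1 h0 i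
    (Finset.mem_univ i)
  have h2 : Real.sin (Real.pi * d i) = 0 := by simpa using this
  obtain ⟨k, hk⟩ := Real.sin_eq_zero_iff.1 h2
  refine ⟨k, ?_⟩
  have := Real.pi_pos
  have h3 : Real.pi * (d i - k) = 0 := by linarith
  rcases mul_eq_zero.1 h3 with h | h <;> linarith

lemma Phi_fderiv (d : Euc n) :
    HasFDerivAt (Phi : Euc n → ℝ) (InnerProductSpace.toDual ℝ (Euc n) (GPhi d)) d := by
  have : ∀ i ∈ (Finset.univ : Finset (Fin n)), HasFDerivAt (fun d : Euc n => Real.sin (Real.pi * d i) ^ 2)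
      ((2 * Real.pi * Real.sin (Real.pi * d i) * Real.cos (Real.pi * d i)) •
        (EuclideanSpace.proj i : Euc n →L[ℝ] ℝ)) d := by
    intro i _
    have h1 : HasFDerivAt (fun d : Euc n => d i) (EuclideanSpace.proj i : Euc n →L[ℝ] ℝ) d :=
      (EuclideanSpace.proj i : Euc n →L[ℝ] ℝ).hasFDerivAt
    have h2 : HasDerivAt (fun t : ℝ => Real.sin (Real.pi * t) ^ 2)
      (2 * Real.pi * Real.sin (Real.pi * d i) * Real.cos (Real.pi * d i)) (d i) := by
      have := (((hasDerivAt_id (d i)).const_mul Real.pi).sin).pow 2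
      refine this.congr_deriv ?_
      simp only [id]; push_cast; ring
    exact h2.comp_hasFDerivAt d h1
  have := HasFDerivAt.fun_sum this
  refine HasFDerivAt.congr_fderiv this ?_
  ext v
  simp [GPhi, PiLp.inner_apply, mul_comm]

lemma Phi_le (d : Euc n) : Phi d ≤ (Real.pi * ‖d‖) ^ 2 := by
  rw [mul_pow, EuclideanSpace.norm_sq_eq, Finset.mul_sum]
  refine Finset.sum_le_sum fun i _ => ?_
  rw [Real.norm_eq_abs, sq_abs, ← mul_pow, sq_le_sq]
  exact Real.abs_sin_le_abs

lemma GPhi_lower {d : Euc n} (h : Phi d ≤ 1/4) : 4 * Phi d ≤ ‖GPhi d‖ ^ 2 := by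
  rw [EuclideanSpace.norm_sq_eq]
  unfold Phi
  rw [Finset.mul_sum]
  refine Finset.sum_le_sum fun i _ => ?_
  have h1 : Real.sin (Real.pi * d i) ^ 2 ≤ 1/4 :=
    (Finset.single_le_sum (f := fun i => Real.sin (Real.pi * d i) ^ 2)
      (fun i _ => sq_nonneg _) (Finset.mem_univ i)).trans h
  have h2 := Real.sin_sq_add_cos_sq (Real.pi * d i)
  have h3 := Real.pi_gt_three
  have h4 : (9:ℝ) ≤ Real.pi ^ 2 := by nlinarith
  simp only [GPhi, Real.norm_eq_abs, sq_abs]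
  have h5 : (3/4 : ℝ) ≤ Real.cos (Real.pi * d i) ^ 2 := by linarith
  have h6 : (1:ℝ) ≤ Real.pi ^ 2 * Real.cos (Real.pi * d i) ^ 2 := by nlinarith
  nlinarith [sq_nonneg (Real.sin (Real.pi * d i))]

lemma grad_of {f : Euc n → ℝ} {G x : Euc n}
    (h : HasFDerivAt f (InnerProductSpace.toDual ℝ (Euc n) G) x) : gradient f x = G :=
  (hasGradientAt_iff_hasFDerivAt.2 h).gradient

/-- Ultrafilter limits in compact sets. -/
lemma ultra_lim {X ι : Type*} [TopologicalSpace X] {s : Set X} (hs : IsCompact s) (U : Ultrafilter ι)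
    (f : ι → X) (hf : ∀ᶠ k in (U : Filter ι), f k ∈ s) : ∃ a ∈ s, Tendsto f U (𝓝 a) := by
  obtain ⟨a, ha, h⟩ := hs.ultrafilter_le_nhds (U.map f) (le_principal_iff.2 hf)
  exact ⟨a, ha, h⟩

variable {Ξ : Type*} [MetricSpace Ξ] [CompactSpace Ξ] [Nonempty Ξ]
    {g : Fin m → Euc n × Ξ → Euc n} {L : Fin m → Euc n × Ξ → ℝ}

lemma ham_bdd (hgL : GoodData g L) (i : Fin m) (x p : Euc n) :
    BddAbove (Set.range fun ξ : Ξ => (-⟪g i (x, ξ), p⟫ - L i (x, ξ))) := by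
  have h1 := (hgL.1 i).1
  have h2 := (hgL.2 i).1
  apply IsCompact.bddAbove
  apply isCompact_range
  fun_prop

lemma ham_cont (hgL : GoodData g L) (i : Fin m) :
    Continuous (fun q : Euc n × Euc n => ham g L i q.1 q.2) := by
  have h1 := (hgL.1 i).1
  have h2 := (hgL.2 i).1
  have := IsCompact.continuous_sSup (K := (Set.univ : Set Ξ)) isCompact_univ
    (f := fun (q : Euc n × Euc n) ξ => (-⟪g i (q.1, ξ), q.2⟫ - L i (q.1, ξ)))
    (by simp only [Function.HasUncurry.uncurry, id]; fun_prop)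
  simpa [ham, iSup] using this

lemma ham_torus (hgL : GoodData g L) (i : Fin m) (p : Euc n) : TorusFun (fun x => ham g L i x p) := by
  intro x z hz
  simp only [ham]
  congr 1
  ext ξ
  rw [(hgL.1 i).2 x z ξ hz, (hgL.2 i).2 x z ξ hz]

lemma ham_convex (hgL : GoodData g L) (i : Fin m) (x p1 p2 : Euc n) {s t : ℝ} (hs : 0 < s) (ht : 0 < t)
    (hst : s + t = 1) :
    ham g L i x (s • p1 + t • p2) ≤ s * ham g L i x p1 + t * ham g L i x p2 := by
  apply ciSup_le
  intro ξ
  have h1 := le_ciSup (ham_bdd hgL i x p1) ξ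
  have h2 := le_ciSup (ham_bdd hgL i x p2) ξ
  have h3 := mul_le_mul_of_nonneg_left h1 hs.le
  have h4 := mul_le_mul_of_nonneg_left h2 ht.le
  have h5 : s * L i (x, ξ) + t * L i (x, ξ) = L i (x, ξ) := by rw [← add_mul, hst, one_mul]
  rw [inner_add_right, inner_smul_right, inner_smul_right]
  unfold ham
  linarith

/-- The left-hand side of the `i`-th equation. -/
noncomputable def lhs (B : Euc n → Matrix (Fin m) (Fin m) ℝ) (lam : ℝ)
    (g : Fin m → Euc n × Ξ → Euc n) (L : Fin m → Euc n × Ξ → ℝ) (u : Fin m → Euc n → ℝ)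
    (i : Fin m) (x p : Euc n) : ℝ :=
  lam * u i x + (∑ j, B x i j * u j x) + ham g L i x p

variable {B : Euc n → Matrix (Fin m) (Fin m) ℝ}

lemma lhs_cont (hgL : GoodData g L) (hB : GoodCoupling B) {u : Fin m → Euc n → ℝ}
    (hu : ∀ i, Continuous (u i)) (lam : ℝ) (i : Fin m) :
    Continuous (fun q : Euc n × Euc n => lhs B lam g L u i q.1 q.2) := by
  unfold lhs
  refine ((continuous_const.mul ((hu i).comp continuous_fst)).add
    (continuous_finsetSum _ fun j _ => ?_)).add (ham_cont hgL i)
  exact ((hB.1 i j).1.comp continuous_fst).mul ((hu j).comp continuous_fst)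

lemma lhs_torus (hgL : GoodData g L) (hB : GoodCoupling B) {u : Fin m → Euc n → ℝ}
    (hu : ∀ i, TorusFun (u i)) (lam : ℝ) (i : Fin m) (p : Euc n) :
    TorusFun (fun x => lhs B lam g L u i x p) := by
  intro x z hz
  simp only [lhs]
  have e : ham g L i (x + z) p = ham g L i x p := ham_torus hgL i p x z hz
  rw [hu i x z hz, e]
  congr 2
  refine Finset.sum_congr rfl fun j _ => ?_
  have e2 : B (x + z) i j = B x i j := (hB.1 i j).2 x z hz
  rw [e2, hu j x z hz]

lemma p_bound (hcoer : Coercive g L) (hB : GoodCoupling B) (Λ C : ℝ) :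
    ∃ R : ℝ, ∀ lam : ℝ, |lam| ≤ Λ → ∀ u : Fin m → Euc n → ℝ, (∀ i x, |u i x| ≤ C) →
      ∀ i x p, lhs B lam g L u i x p ≤ 0 → ‖p‖ ≤ R := by
  have h1 : ∀ i j, ∃ C, ∀ x, |B x i j| ≤ C := fun i j => torus_bdd (hB.1 i j).2 (hB.1 i j).1
  choose b hb using h1
  choose R hR using fun i => hcoer i (Λ * C + ∑ j, b i j * C + 1)
  refine ⟨∑ i, |R i|, fun lam hlam u hu i x p h => ?_⟩
  have h2 : ‖p‖ < R i := by
    by_contra hcon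
    have h3 := hR i p (not_lt.1 hcon) x
    have h4 : |lam * u i x| ≤ Λ * C := by
      rw [abs_mul]
      exact mul_le_mul hlam (hu i x) (abs_nonneg _) ((abs_nonneg _).trans hlam)
    have h5 : |∑ j, B x i j * u j x| ≤ ∑ j, b i j * C := by
      refine (Finset.abs_sum_le_sum_abs _ _).trans (Finset.sum_le_sum fun j _ => ?_)
      rw [abs_mul]
      exact mul_le_mul (hb i j x) (hu j x) (abs_nonneg _) ((abs_nonneg _).trans (hb i j x))
    have h6 := neg_abs_le (lam * u i x)
    have h7 := neg_abs_le (∑ j, B x i j * u j x)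
    unfold lhs at h
    linarith
  calc ‖p‖ ≤ R i := h2.le
    _ ≤ |R i| := le_abs_self _
    _ ≤ _ := Finset.single_le_sum (f := fun i => |R i|) (fun i _ => abs_nonneg _) (Finset.mem_univ i)

lemma torus_bdd' {u : Fin m → Euc n → ℝ} (hf : ∀ i, TorusFun (u i)) (hc : ∀ i, Continuous (u i)) :
    ∃ C, ∀ i x, |u i x| ≤ C := by
  choose b hb using fun i => torus_bdd (hf i) (hc i)
  exact ⟨∑ i, |b i|, fun i x => ((hb i x).trans (le_abs_self _)).trans
    (Finset.single_le_sum (f := fun i => |b i|) (fun i _ => abs_nonneg _) (Finset.mem_univ i))⟩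

lemma torus_sub {f : Euc n → ℝ} (hf : TorusFun f) (c : ℝ) (z : Euc n) :
    TorusFun (fun x => c * f (x - z)) := by
  intro x w hw
  simp only
  rw [show x + w - z = (x - z) + w by abel, hf _ _ hw]

lemma torus_sub' {f : Euc n → ℝ} (hf : TorusFun f) (z : Euc n) :
    TorusFun (fun x => f (z - x)) := by
  intro x w hw
  simp only
  rw [show z - (x + w) = (z - x) + -w by abel, hf _ _ hw.neg']

lemma grad_pen (c : ℝ) (x z : Euc n) :
    gradient (fun x => c * Phi (x - z)) x = c • GPhi (x - z) := by
  apply grad_of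
  have h := ((Phi_fderiv (x - z)).comp x ((hasFDerivAt_id x).sub_const z)).const_mul c
  refine h.congr_fderiv ?_
  ext v
  simp

lemma grad_pen' (c : ℝ) (x y z : Euc n) :
    gradient (fun z => -(c * (Phi (x - z) + Phi (y - z)))) z = c • (GPhi (x - z) + GPhi (y - z)) := by
  apply grad_of
  have h1 := ((Phi_fderiv (x - z)).comp z ((hasFDerivAt_id z).const_sub x))
  have h2 := ((Phi_fderiv (y - z)).comp z ((hasFDerivAt_id z).const_sub y))
  refine (((h1.add h2).const_mul c).neg).congr_fderiv ?_
  ext v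
  simp
  ring

lemma doubling (hm : 0 < m) {l1 l2 l0 : ℝ} {u1 u2 w : Fin m → Euc n → ℝ}
    (h1 : IsSubsol B l1 g L (fun _ => 0) u1) (c1 : ∀ i, Continuous (u1 i))
    (h2 : IsSubsol B l2 g L (fun _ => 0) u2) (c2 : ∀ i, Continuous (u2 i))
    (h0 : IsSupersol B l0 g L (fun _ => 0) w) (c0 : ∀ i, Continuous (w i))
    {s t : ℝ} (hs : 0 < s) (ht : 0 < t) (c : ℝ) :
    ∃ i, ∃ x ∈ cube n, ∃ y ∈ cube n, ∃ z ∈ cube n, ∃ p1 p2 : Euc n,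
      lhs B l1 g L u1 i x p1 ≤ 0 ∧ lhs B l2 g L u2 i y p2 ≤ 0 ∧
      0 ≤ lhs B l0 g L w i z (s • p1 + t • p2) ∧
      ∀ j a, s * u1 j a + t * u2 j a - w j a + c * (Phi (x - z) + Phi (y - z)) ≤
        s * u1 i x + t * u2 i y - w i z := by
  have hmax : ∀ i, ∃ q ∈ (cube n) ×ˢ ((cube n) ×ˢ (cube n)), ∀ q' ∈ (cube n) ×ˢ ((cube n) ×ˢ (cube n)),
      s * u1 i q'.1 + t * u2 i q'.2.1 - w i q'.2.2 - c * (Phi (q'.1 - q'.2.2) + Phi (q'.2.1 - q'.2.2)) ≤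
      s * u1 i q.1 + t * u2 i q.2.1 - w i q.2.2 - c * (Phi (q.1 - q.2.2) + Phi (q.2.1 - q.2.2)) := by
    intro i
    have hc := (cube_compact n).prod ((cube_compact n).prod (cube_compact n))
    have := c1 i; have := c2 i; have := c0 i; have := Phi_cont (n := n)
    have hF : Continuous (fun q' : Euc n × Euc n × Euc n => s * u1 i q'.1 + t * u2 i q'.2.1 - w i q'.2.2
        - c * (Phi (q'.1 - q'.2.2) + Phi (q'.2.1 - q'.2.2))) := by fun_prop
    exact hc.exists_isMaxOn ⟨(0, 0, 0), cube_zero n, cube_zero n, cube_zero n⟩ hF.continuousOn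
  choose q hq hqm using hmax
  have : Nonempty (Fin m) := ⟨⟨0, hm⟩⟩
  obtain ⟨i, hi⟩ := Finite.exists_max (fun i => s * u1 i (q i).1 + t * u2 i (q i).2.1 - w i (q i).2.2
    - c * (Phi ((q i).1 - (q i).2.2) + Phi ((q i).2.1 - (q i).2.2)))
  obtain ⟨hx, hy, hz⟩ := hq i
  have key : ∀ j a b d, s * u1 j a + t * u2 j b - w j d - c * (Phi (a - d) + Phi (b - d)) ≤
      s * u1 i (q i).1 + t * u2 i (q i).2.1 - w i (q i).2.2
    - c * (Phi ((q i).1 - (q i).2.2) + Phi ((q i).2.1 - (q i).2.2)) := by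
    intro j a b d
    obtain ⟨za, hza, ha⟩ := exists_rep a
    obtain ⟨zb, hzb, hb⟩ := exists_rep b
    obtain ⟨zd, hzd, hd⟩ := exists_rep d
    have e := (hqm j (a + za, b + zb, d + zd) ⟨ha, hb, hd⟩).trans (hi j)
    have e1 : ∀ x z zx zz : Euc n, IsIntVec zx → IsIntVec zz → Phi (x + zx - (z + zz)) = Phi (x - z) := by
      intro x z zx zz h1 h2
      rw [show x + zx - (z + zz) = (x - z) + zx + -zz by abel, Phi_torus _ _ h2.neg', Phi_torus _ _ h1]
    simp only [(h1.1 j).2 a za hza, (h2.1 j).2 b zb hzb, (h0.1 j).2 d zd hzd, e1 a d za zd hza hzd,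
      e1 b d zb zd hzb hzd] at e
    exact e
  set X := (q i).1 with hX
  set Y := (q i).2.1
  set Z := (q i).2.2
  refine ⟨i, X, hx, Y, hy, Z, hz, (c / s) • GPhi (X - Z), (c / t) • GPhi (Y - Z), ?_, ?_, ?_, ?_⟩
  · have := h1.2 i (fun x => (c / s) * Phi (x - Z)) (contDiff_const.mul (Phi_contDiff.comp
      (contDiff_id.sub contDiff_const))) (torus_sub Phi_torus _ _) X
      (Filter.Eventually.of_forall fun a => by
        have := key i a Y Z
        have e1 : s * (c / s * Phi (a - Z)) = c * Phi (a - Z) := by field_simp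
        have e2 : s * (c / s * Phi (X - Z)) = c * Phi (X - Z) := by field_simp
        have e3 : s * (u1 i a - c / s * Phi (a - Z)) ≤ s * (u1 i X - c / s * Phi (X - Z)) := by
          rw [mul_sub, mul_sub, e1, e2]; linarith
        exact le_of_mul_le_mul_left e3 hs)
    rw [grad_pen] at this
    exact this
  · have := h2.2 i (fun x => (c / t) * Phi (x - Z)) (contDiff_const.mul (Phi_contDiff.comp
      (contDiff_id.sub contDiff_const))) (torus_sub Phi_torus _ _) Y
      (Filter.Eventually.of_forall fun a => by
        have := key i X a Z
        have e1 : t * (c / t * Phi (a - Z)) = c * Phi (a - Z) := by field_simp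
        have e2 : t * (c / t * Phi (Y - Z)) = c * Phi (Y - Z) := by field_simp
        have e3 : t * (u2 i a - c / t * Phi (a - Z)) ≤ t * (u2 i Y - c / t * Phi (Y - Z)) := by
          rw [mul_sub, mul_sub, e1, e2]; linarith
        exact le_of_mul_le_mul_left e3 ht)
    rw [grad_pen] at this
    exact this
  · have := h0.2 i (fun z => -(c * (Phi (X - z) + Phi (Y - z)))) ((contDiff_const.mul ((Phi_contDiff.comp
      (contDiff_const.sub contDiff_id)).add (Phi_contDiff.comp
      (contDiff_const.sub contDiff_id)))).neg) (by
        intro a b hb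
        have e1 := torus_sub' Phi_torus X a b hb
        have e2 := torus_sub' Phi_torus Y a b hb
        simp only at e1 e2 ⊢
        rw [e1, e2]) Z
      (Filter.Eventually.of_forall fun a => by
        have := key i X Y a
        simp only
        linarith)
    rw [grad_pen'] at this
    have e : s • (c / s) • GPhi (X - Z) + t • (c / t) • GPhi (Y - Z) = c • (GPhi (X - Z) + GPhi (Y - Z)) := by
      rw [smul_smul, smul_smul, smul_add]
      congr 2 <;> field_simp
    rw [e]
    exact this
  · intro j a
    have := key j a a a
    simp only [sub_self, Phi_zero] at this
    linarith

lemma vcmp (hgL : GoodData g L) (hcoer : Coercive g L) (hB : GoodCoupling B)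
    (hm : 0 < m) {l1 l2 l0 : ℝ} {u1 u2 w : Fin m → Euc n → ℝ}
    (h1 : IsSubsol B l1 g L (fun _ => 0) u1) (c1 : ∀ i, Continuous (u1 i))
    (h2 : IsSubsol B l2 g L (fun _ => 0) u2) (c2 : ∀ i, Continuous (u2 i))
    (h0 : IsSupersol B l0 g L (fun _ => 0) w) (c0 : ∀ i, Continuous (w i))
    {s t : ℝ} (hs : 0 < s) (ht : 0 < t) (hst : s + t = 1) :
    ∃ i x, (∀ j y, s * u1 j y + t * u2 j y - w j y ≤ s * u1 i x + t * u2 i x - w i x) ∧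
      (0 ≤ s * u1 i x + t * u2 i x - w i x →
        s * (l1 * u1 i x) + t * (l2 * u2 i x) ≤ l0 * w i x) := by
  have T1 := fun i => (h1.1 i).2
  have T2 := fun i => (h2.1 i).2
  have T0 := fun i => (h0.1 i).2
  choose I x hx y hy z hz p1 p2 a1 a2 a0 am using fun k : ℕ =>
    doubling hm h1 c1 h2 c2 h0 c0 hs ht ((k : ℝ) + 1)
  obtain ⟨C1, hC1⟩ := torus_bdd' T1 c1
  obtain ⟨C2, hC2⟩ := torus_bdd' T2 c2
  obtain ⟨C0, hC0⟩ := torus_bdd' T0 c0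
  obtain ⟨R1, hR1⟩ := p_bound hcoer hB |l1| C1
  obtain ⟨R2, hR2⟩ := p_bound hcoer hB |l2| C2
  have b1 : ∀ k, p1 k ∈ Metric.closedBall (0 : Euc n) R1 := fun k => by
    simpa using hR1 l1 le_rfl u1 hC1 (I k) (x k) (p1 k) (a1 k)
  have b2 : ∀ k, p2 k ∈ Metric.closedBall (0 : Euc n) R2 := fun k => by
    simpa using hR2 l2 le_rfl u2 hC2 (I k) (y k) (p2 k) (a2 k)
  let U : Ultrafilter ℕ := hyperfilter ℕ
  have hU : (U : Filter ℕ) ≤ atTop := Nat.hyperfilter_le_atTop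
  obtain ⟨i, -, hI⟩ := ultra_lim (isCompact_univ (X := Fin m)) U I (Eventually.of_forall fun _ => Set.mem_univ _)
  rw [nhds_discrete, tendsto_pure] at hI
  obtain ⟨x', hx', lx⟩ := ultra_lim (cube_compact n) U x (Eventually.of_forall hx)
  obtain ⟨y', hy', ly⟩ := ultra_lim (cube_compact n) U y (Eventually.of_forall hy)
  obtain ⟨z', hz', lz⟩ := ultra_lim (cube_compact n) U z (Eventually.of_forall hz)
  obtain ⟨p1', -, lp1⟩ := ultra_lim (isCompact_closedBall (0 : Euc n) R1) U p1 (Eventually.of_forall b1)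
  obtain ⟨p2', -, lp2⟩ := ultra_lim (isCompact_closedBall (0 : Euc n) R2) U p2 (Eventually.of_forall b2)
  have A1 : lhs B l1 g L u1 i x' p1' ≤ 0 := by
    have := ((lhs_cont hgL hB c1 l1 i).tendsto (x', p1')).comp (lx.prodMk_nhds lp1)
    refine le_of_tendsto this ?_
    filter_upwards [hI] with k hk
    rw [← hk]; exact a1 k
  have A2 : lhs B l2 g L u2 i y' p2' ≤ 0 := by
    have := ((lhs_cont hgL hB c2 l2 i).tendsto (y', p2')).comp (ly.prodMk_nhds lp2)
    refine le_of_tendsto this ?_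
    filter_upwards [hI] with k hk
    rw [← hk]; exact a2 k
  have A0 : 0 ≤ lhs B l0 g L w i z' (s • p1' + t • p2') := by
    have := ((lhs_cont hgL hB c0 l0 i).tendsto (z', s • p1' + t • p2')).comp
      (lz.prodMk_nhds ((lp1.const_smul s).add (lp2.const_smul t)))
    refine ge_of_tendsto this ?_
    filter_upwards [hI] with k hk
    rw [← hk]; exact a0 k
  -- limits of the penalization
  have hD : ∀ k, Phi (x k - z k) + Phi (y k - z k) ≤ (2 * (s * C1 + t * C2 + C0)) * (1 / ((k : ℝ) + 1)) := by
    intro k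
    have e := am k (I k) (x k)
    have f1 := abs_le.1 (hC1 (I k) (x k))
    have f2 := abs_le.1 (hC2 (I k) (x k))
    have f3 := abs_le.1 (hC0 (I k) (x k))
    have f4 := abs_le.1 (hC2 (I k) (y k))
    have f5 := abs_le.1 (hC0 (I k) (z k))
    have g1 := mul_le_mul_of_nonneg_left f2.1 ht.le
    have g2 := mul_le_mul_of_nonneg_left f4.2 ht.le
    have g3 : 0 ≤ s * C1 := mul_nonneg hs.le ((abs_nonneg _).trans (hC1 (I k) (x k)))
    have hk : (0 : ℝ) < (k : ℝ) + 1 := by positivity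
    rw [mul_one_div, le_div_iff₀ hk]
    linarith
  have hDlim : Tendsto (fun k : ℕ => (2 * (s * C1 + t * C2 + C0)) * (1 / ((k : ℝ) + 1))) U (𝓝 0) := by
    have := (tendsto_one_div_add_atTop_nhds_zero_nat (𝕜 := ℝ)).const_mul (2 * (s * C1 + t * C2 + C0))
    rw [mul_zero] at this
    exact this.mono_left hU
  have lxz : Tendsto (fun k => Phi (x k - z k)) U (𝓝 (Phi (x' - z'))) :=
    (Phi_cont.tendsto _).comp (lx.sub lz)
  have lyz : Tendsto (fun k => Phi (y k - z k)) U (𝓝 (Phi (y' - z'))) :=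
    (Phi_cont.tendsto _).comp (ly.sub lz)
  have hsum : Phi (x' - z') + Phi (y' - z') ≤ 0 :=
    le_of_tendsto_of_tendsto' (lxz.add lyz) hDlim hD
  have zx : IsIntVec (x' - z') := Phi_eq_zero (by linarith [Phi_nonneg (y' - z')])
  have zy : IsIntVec (y' - z') := Phi_eq_zero (by linarith [Phi_nonneg (x' - z')])
  have M : ∀ j a, s * u1 j a + t * u2 j a - w j a ≤ s * u1 i z' + t * u2 i z' - w i z' := by
    intro j a
    rw [← torus_eq (T1 i) zx, ← torus_eq (T2 i) zy]
    have := ((((c1 i).tendsto x').comp lx).const_mul s).add ((((c2 i).tendsto y').comp ly).const_mul t)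
    have := this.sub (((c0 i).tendsto z').comp lz)
    refine ge_of_tendsto this ?_
    filter_upwards [hI] with k hk
    have e := am k j a
    have : 0 ≤ ((k : ℝ) + 1) * (Phi (x k - z k) + Phi (y k - z k)) :=
      mul_nonneg (by positivity) (add_nonneg (Phi_nonneg _) (Phi_nonneg _))
    simp only [Function.comp]
    rw [hk] at e
    linarith
  refine ⟨i, z', M, fun hpos => ?_⟩
  have B1 : lhs B l1 g L u1 i z' p1' ≤ 0 := by
    rw [← torus_eq (lhs_torus hgL hB T1 l1 i p1') zx]; exact A1
  have B2 : lhs B l2 g L u2 i z' p2' ≤ 0 := by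
    rw [← torus_eq (lhs_torus hgL hB T2 l2 i p2') zy]; exact A2
  have hmono := hB.2 z' (fun j => s * u1 j z' + t * u2 j z' - w j z') i (fun j => M j z') hpos
  have esum : ∑ j, B z' i j * (s * u1 j z' + t * u2 j z' - w j z') =
      s * (∑ j, B z' i j * u1 j z') + t * (∑ j, B z' i j * u2 j z') - ∑ j, B z' i j * w j z' := by
    rw [Finset.mul_sum, Finset.mul_sum, ← Finset.sum_add_distrib, ← Finset.sum_sub_distrib]
    exact Finset.sum_congr rfl fun j _ => by ring
  rw [esum] at hmono
  have hcv := ham_convex hgL i z' p1' p2' hs ht hst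
  have D1 := mul_nonpos_of_nonneg_of_nonpos hs.le B1
  have D2 := mul_nonpos_of_nonneg_of_nonpos ht.le B2
  unfold lhs at A0 D1 D2
  nlinarith

lemma lip_step {C R η : ℝ} (hR : 0 ≤ R) (hη : 0 < η) (hη' : η ≤ 1/4) {u : Euc n → ℝ}
    (hc : Continuous u) (ht : TorusFun u) (hb : ∀ x, |u x| ≤ C)
    (htest : ∀ ψ : Euc n → ℝ, ContDiff ℝ 1 ψ → TorusFun ψ → ∀ x, IsLocalMax (fun y => u y - ψ y) x →
      ‖gradient ψ x‖ ≤ R) (x : Euc n) :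
    ∃ y' ∈ cube n, Phi (y' - x) ≤ η ^ 2 ∧
      ∀ y, u y - (2 * R + 8 * C + 1) * √(Phi (y - x) + η ^ 2) ≤ u y' := by
  have hC : 0 ≤ C := (abs_nonneg _).trans (hb 0)
  set K := 2 * R + 8 * C + 1 with hK
  have hpos : ∀ y, 0 < Phi (y - x) + η ^ 2 := fun y => by
    have := Phi_nonneg (y - x); positivity
  set ψ : Euc n → ℝ := fun y => K * √(Phi (y - x) + η ^ 2) with hψ
  have hψ1 : ContDiff ℝ 1 ψ :=
    contDiff_const.mul (ContDiff.sqrt ((Phi_contDiff.comp (contDiff_id.sub contDiff_const)).add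
      contDiff_const) (fun y => (hpos y).ne'))
  have hψt : TorusFun ψ := by
    intro a b hab
    have := torus_sub Phi_torus 1 x a b hab
    simp only [one_mul] at this
    simp only [hψ, this]
  obtain ⟨y', hy', hmax⟩ := (cube_compact n).exists_isMaxOn ⟨0, cube_zero n⟩
    (f := fun y => u y - ψ y) (hc.sub hψ1.continuous).continuousOn
  have hglob : ∀ y, u y - ψ y ≤ u y' - ψ y' := by
    intro y
    obtain ⟨z, hz, hzc⟩ := exists_rep y
    have : u (y + z) - ψ (y + z) ≤ u y' - ψ y' := hmax hzc
    rwa [ht y z hz, hψt y z hz] at this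
  have hgr := htest ψ hψ1 hψt y' (Eventually.of_forall hglob)
  set S := √(Phi (y' - x) + η ^ 2) with hS
  have hSpos : 0 < S := Real.sqrt_pos.2 (hpos y')
  have hSsq : S ^ 2 = Phi (y' - x) + η ^ 2 := Real.sq_sqrt (hpos y').le
  have hgrad : gradient ψ y' = (K / (2 * S)) • GPhi (y' - x) := by
    apply grad_of
    have h1 := ((Phi_fderiv (y' - x)).comp y' ((hasFDerivAt_id y').sub_const x)).add_const (η ^ 2)
    have h2 := (HasFDerivAt.sqrt h1 (hpos y').ne').const_mul K
    refine h2.congr_fderiv ?_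
    ext v
    simp [← hS]
    ring
  have hself := hglob x
  have e0 : ψ x = K * η := by
    simp [hψ, Phi_zero, Real.sqrt_sq hη.le]
  have e1 : ψ y' = K * S := rfl
  have f1 := abs_le.1 (hb x)
  have f2 := abs_le.1 (hb y')
  have hKpos : 0 < K := by positivity
  have hS2 : S ≤ 1/2 := by
    have : K * (S - η) ≤ K * (1/4) := by
      rw [e0, e1] at hself; nlinarith
    have := le_of_mul_le_mul_left this hKpos
    linarith
  have hPhi : Phi (y' - x) ≤ 1/4 := by nlinarith [sq_nonneg η]
  have hlow := GPhi_lower hPhi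
  have hn2 : K ^ 2 * Phi (y' - x) ≤ R ^ 2 * S ^ 2 := by
    have h3 : ‖gradient ψ y'‖ ^ 2 ≤ R ^ 2 := pow_le_pow_left₀ (norm_nonneg _) hgr 2
    rw [hgrad, norm_smul, mul_pow, Real.norm_eq_abs, sq_abs, div_pow] at h3
    have h4 : K ^ 2 / (2 * S) ^ 2 * (4 * Phi (y' - x)) ≤ R ^ 2 :=
      (mul_le_mul_of_nonneg_left hlow (by positivity)).trans h3
    have h5 : K ^ 2 / (2 * S) ^ 2 * (4 * Phi (y' - x)) = K ^ 2 * Phi (y' - x) / S ^ 2 := by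
      field_simp; ring
    rw [h5, div_le_iff₀ (by positivity)] at h4
    exact h4
  refine ⟨y', hy', ?_, fun y => ?_⟩
  · by_contra hcon
    push Not at hcon
    have hP := Phi_nonneg (y' - x)
    have hK2 : 4 * R ^ 2 + 1 ≤ K ^ 2 := by
      have : 2 * R + 1 ≤ K := by rw [hK]; linarith
      nlinarith
    rw [hSsq] at hn2
    have h6 : (4 * R ^ 2 + 1) * Phi (y' - x) ≤ R ^ 2 * (Phi (y' - x) + η ^ 2) :=
      (mul_le_mul_of_nonneg_right hK2 hP).trans hn2
    nlinarith [mul_le_mul_of_nonneg_left hcon.le (sq_nonneg R), sq_nonneg η,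
      mul_nonneg (sq_nonneg R) hP]
  · have := hglob y
    have : 0 ≤ ψ y' := by rw [e1]; positivity
    have e2 : ψ y = K * √(Phi (y - x) + η ^ 2) := rfl
    linarith

lemma equi_lip {C R : ℝ} (hR : 0 ≤ R) {u : Euc n → ℝ}
    (hc : Continuous u) (ht : TorusFun u) (hb : ∀ x, |u x| ≤ C)
    (htest : ∀ ψ : Euc n → ℝ, ContDiff ℝ 1 ψ → TorusFun ψ → ∀ x, IsLocalMax (fun y => u y - ψ y) x →
      ‖gradient ψ x‖ ≤ R) (x y : Euc n) :
    u y - u x ≤ (2 * R + 8 * C + 1) * Real.pi * ‖y - x‖ := by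
  have hC : 0 ≤ C := (abs_nonneg _).trans (hb 0)
  have hη : ∀ k : ℕ, (0:ℝ) < 1 / ((k : ℝ) + 1) * (1/4) := fun k => by positivity
  have hη' : ∀ k : ℕ, 1 / ((k : ℝ) + 1) * (1/4) ≤ (1/4 : ℝ) := fun k => by
    have h1 : 1 / ((k : ℝ) + 1) ≤ 1 := by
      rw [div_le_one (by positivity)]; linarith [(Nat.cast_nonneg k : (0:ℝ) ≤ k)]
    linarith
  choose Y hY hPhi hle using fun k : ℕ => lip_step hR (hη k) (hη' k) hc ht hb htest x
  let U : Ultrafilter ℕ := hyperfilter ℕ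
  have hU : (U : Filter ℕ) ≤ atTop := Nat.hyperfilter_le_atTop
  obtain ⟨y', -, ly⟩ := ultra_lim (cube_compact n) U Y (Eventually.of_forall hY)
  have lη : Tendsto (fun k : ℕ => (1 / ((k : ℝ) + 1) * (1/4)) ^ 2) U (𝓝 0) := by
    have := ((tendsto_one_div_add_atTop_nhds_zero_nat (𝕜 := ℝ)).mul_const (1/4)).pow 2
    simp only [zero_mul, ne_eq, OfNat.ofNat_ne_zero, not_false_eq_true, zero_pow] at this
    exact this.mono_left hU
  have hint : IsIntVec (y' - x) := by
    apply Phi_eq_zero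
    exact le_of_tendsto_of_tendsto' ((Phi_cont.tendsto _).comp (ly.sub_const x)) lη hPhi
  have hfin : u y - (2 * R + 8 * C + 1) * √(Phi (y - x) + 0) ≤ u x := by
    rw [← torus_eq ht hint]
    refine le_of_tendsto_of_tendsto' ?_ ((hc.tendsto y').comp ly) (fun k => hle k y)
    refine Tendsto.const_sub _ (Tendsto.const_mul _ ?_)
    exact (Real.continuous_sqrt.tendsto _).comp (tendsto_const_nhds.add lη)
  have h1 : √(Phi (y - x) + 0) ≤ Real.pi * ‖y - x‖ := by
    rw [add_zero]
    exact Real.sqrt_le_iff.2 ⟨by positivity, Phi_le _⟩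
  have h2 := mul_le_mul_of_nonneg_left h1 (show 0 ≤ 2 * R + 8 * C + 1 by positivity)
  rw [mul_assoc]
  linarith

lemma unif_of_ptwise {ι : Type*} {l : Filter ι} {f : ι → Euc n → ℝ} {f0 : Euc n → ℝ} {K : ℝ}
    (hf : ∀ᶠ k in l, TorusFun (f k) ∧ ∀ x y, f k y - f k x ≤ K * ‖y - x‖)
    (h0t : TorusFun f0) (h0 : ∀ x y, f0 y - f0 x ≤ K * ‖y - x‖)
    (hpt : ∀ x, Tendsto (fun k => f k x) l (𝓝 (f0 x))) : TendstoUniformly f f0 l := by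
  rw [Metric.tendstoUniformly_iff]
  intro ε hε
  have hr : 0 < ε / (3 * (|K| + 1)) := by positivity
  obtain ⟨t, -, hfin, hcov⟩ := (cube_compact n).finite_cover_balls hr
  have hev : ∀ᶠ k in l, ∀ y ∈ t, dist (f k y) (f0 y) < ε / 3 := by
    rw [eventually_all_finite hfin]
    intro y _
    exact (Metric.tendsto_nhds.1 (hpt y)) (ε/3) (by positivity)
  filter_upwards [hf, hev] with k hk hk2 x
  obtain ⟨z, hz, hzc⟩ := exists_rep x
  rw [← h0t x z hz, ← hk.1 x z hz]
  obtain ⟨y, hy, hxy⟩ := Set.mem_iUnion₂.1 (hcov hzc)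
  set X := x + z
  rw [Metric.mem_ball, dist_eq_norm] at hxy
  have hKn : K * ‖X - y‖ < ε / 3 := by
    have h1 : K * ‖X - y‖ ≤ (|K| + 1) * ‖X - y‖ :=
      mul_le_mul_of_nonneg_right (by linarith [le_abs_self K]) (norm_nonneg _)
    have h2 : (|K| + 1) * ‖X - y‖ < (|K| + 1) * (ε / (3 * (|K| + 1))) :=
      mul_lt_mul_of_pos_left hxy (by positivity)
    have h3 : (|K| + 1) * (ε / (3 * (|K| + 1))) = ε / 3 := by field_simp
    linarith
  have a1 := h0 y X
  have a2 := h0 X y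
  have a3 := hk.2 y X
  have a4 := hk.2 X y
  rw [norm_sub_rev y X] at a2 a4
  have a5 := hk2 y hy
  rw [Real.dist_eq, abs_lt] at a5 ⊢
  constructor <;> linarith

lemma grad_cont {ψ : Euc n → ℝ} (h : ContDiff ℝ 1 ψ) : Continuous (gradient ψ) :=
  (InnerProductSpace.toDual ℝ (Euc n)).symm.continuous.comp (h.continuous_fderiv one_ne_zero)

lemma stab_core {ι : Type*} {l : Filter ι} {f : ι → Euc n → ℝ} {f0 : Euc n → ℝ}
    (hu : TendstoUniformly f f0 l) (hc0 : Continuous f0) (hc : ∀ᶠ k in l, Continuous (f k))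
    {ψ : Euc n → ℝ} (hψ : Continuous ψ) {x : Euc n} (hmax : IsLocalMax (fun y => f0 y - ψ y) x) :
    ∃ X : ι → Euc n, Tendsto X l (𝓝 x) ∧
      ∀ᶠ k in l, IsLocalMax (fun y => f k y - (ψ y + Phi (y - x))) (X k) := by
  obtain ⟨r, hr, hball⟩ := Metric.eventually_nhds_iff_ball.1 hmax
  set ρ := min (r / 2) (1 / 2) with hρ
  have hρpos : 0 < ρ := by positivity
  have hK : IsCompact (Metric.closedBall x ρ) := isCompact_closedBall x ρ
  have hex : ∀ k, ∃ y ∈ Metric.closedBall x ρ, Continuous (f k) → ∀ y' ∈ Metric.closedBall x ρ,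
      f k y' - (ψ y' + Phi (y' - x)) ≤ f k y - (ψ y + Phi (y - x)) := by
    intro k
    by_cases hk : Continuous (f k)
    · have hΦ := Phi_cont (n := n)
      have hF : Continuous (fun y => f k y - (ψ y + Phi (y - x))) := by fun_prop
      obtain ⟨y, hy, hm⟩ := hK.exists_isMaxOn ⟨x, Metric.mem_closedBall_self hρpos.le⟩ hF.continuousOn
      exact ⟨y, hy, fun _ y' hy' => hm hy'⟩
    · exact ⟨x, Metric.mem_closedBall_self hρpos.le, fun h => absurd h hk⟩
  choose X hX hXm using hex
  have hlim : Tendsto X l (𝓝 x) := by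
    refine hK.tendsto_nhds_of_unique_mapClusterPt (Eventually.of_forall hX) fun y hy hcl => ?_
    obtain ⟨U, hU, hUy⟩ := mapClusterPt_iff_ultrafilter.1 hcl
    have hu' : TendstoUniformly f f0 U := fun s hs => hU (hu s hs)
    have l1 : Tendsto (fun k => f k (X k)) U (𝓝 (f0 y)) := hu'.tendsto_comp hc0.continuousAt hUy
    have l2 : Tendsto (fun k => f k x) U (𝓝 (f0 x)) := hu'.tendsto_at x
    have l3 : Tendsto (fun k => f k (X k) - (ψ (X k) + Phi (X k - x))) U
        (𝓝 (f0 y - (ψ y + Phi (y - x)))) :=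
      l1.sub (((hψ.tendsto y).comp hUy).add ((Phi_cont.tendsto _).comp (hUy.sub_const x)))
    have l4 : Tendsto (fun k => f k x - (ψ x + Phi (x - x))) U
        (𝓝 (f0 x - (ψ x + Phi (x - x)))) := l2.sub_const _
    have hle := le_of_tendsto_of_tendsto l4 l3 (by
      filter_upwards [hU hc] with k hk
      exact hXm k hk x (Metric.mem_closedBall_self hρpos.le))
    rw [sub_self, Phi_zero] at hle
    have hyd : dist y x ≤ ρ := hy
    have hyr : y ∈ Metric.ball x r := by
      rw [Metric.mem_ball]
      have := min_le_left (r / 2) (1 / 2)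
      linarith
    have h2 := hball y hyr
    simp only at h2
    have hint : IsIntVec (y - x) := Phi_eq_zero (by linarith)
    have hsmall : ‖y - x‖ < 1 := by
      rw [← dist_eq_norm]
      have := min_le_right (r / 2) (1 / 2)
      linarith
    have : y - x = 0 := by
      ext i
      obtain ⟨k, hk⟩ := hint i
      have h3 : |(y - x) i| < 1 := (PiLp.norm_apply_le (y - x) i).trans_lt hsmall
      rw [hk] at h3
      have h5 : |(k : ℝ)| < 1 := h3
      have h4 : |k| < 1 := by exact_mod_cast h5
      rw [hk]
      rw [Int.abs_lt_one_iff.1 h4]; simp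
    exact sub_eq_zero.1 this
  refine ⟨X, hlim, ?_⟩
  filter_upwards [hc, hlim (Metric.ball_mem_nhds x hρpos)] with k hk hk2
  filter_upwards [Metric.isOpen_ball.mem_nhds hk2] with y hy
  exact hXm k hk y (Metric.ball_subset_closedBall hy)

lemma GPhi_zero : GPhi (0 : Euc n) = 0 := by
  ext i; simp [GPhi]

lemma grad_pert {ψ : Euc n → ℝ} (h : ContDiff ℝ 1 ψ) (c : ℝ) (x : Euc n) :
    gradient (fun y => ψ y + c * Phi (y - x)) x = gradient ψ x := by
  apply grad_of
  have h0 : HasFDerivAt (fun y : Euc n => y - x) (ContinuousLinearMap.id ℝ (Euc n)) x :=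
    (hasFDerivAt_id x).sub_const x
  have h1 := (HasFDerivAt.comp (f := fun y : Euc n => y - x) x (Phi_fderiv (x - x)) h0).const_mul c
  have h2 := ((h.differentiable one_ne_zero) x).hasFDerivAt.add h1
  refine h2.congr_fderiv ?_
  simp [GPhi_zero]

lemma pert_contDiff {ψ : Euc n → ℝ} (h : ContDiff ℝ 1 ψ) (c : ℝ) (x : Euc n) :
    ContDiff ℝ 1 (fun y => ψ y + c * Phi (y - x)) :=
  h.add (contDiff_const.mul (Phi_contDiff.comp (contDiff_id.sub contDiff_const)))

lemma pert_torus {ψ : Euc n → ℝ} (h : TorusFun ψ) (c : ℝ) (x : Euc n) :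
    TorusFun (fun y => ψ y + c * Phi (y - x)) := by
  intro a b hb
  have := torus_sub Phi_torus c x a b hb
  simp only at this ⊢
  rw [h a b hb, this]

lemma lim1 (hgL : GoodData g L) {ι : Type*} {l : Filter ι}
    {X : ι → Euc n} {x : Euc n} (hX : Tendsto X l (𝓝 x))
    {p : Euc n → Euc n} (hp : Continuous p) (i : Fin m) :
    Tendsto (fun k => ham g L i (X k) (p (X k))) l (𝓝 (ham g L i x (p x))) := by
  have key : ∀ F : Euc n → Euc n → ℝ, Continuous (fun q : Euc n × Euc n => F q.1 q.2) →
      Tendsto (fun k => F (X k) (p (X k))) l (𝓝 (F x (p x))) := by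
    intro F hF
    have hc : Continuous (fun y => F y (p y)) := hF.comp (continuous_id.prodMk hp)
    exact (hc.tendsto x).comp hX
  exact key (ham g L i) (ham_cont hgL i)

lemma lim2 (hB : GoodCoupling B) {ι : Type*} {l : Filter ι}
    {u : ι → Fin m → Euc n → ℝ}
    {u0 : Fin m → Euc n → ℝ} {X : ι → Euc n} {x : Euc n} (hX : Tendsto X l (𝓝 x))
    (h1 : ∀ j, Tendsto (fun k => u k j (X k)) l (𝓝 (u0 j x))) (i : Fin m) :
    Tendsto (fun k => ∑ j, B (X k) i j * u k j (X k)) l (𝓝 (∑ j, B x i j * u0 j x)) := by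
  refine tendsto_finsetSum _ fun j _ => ?_
  have hb : Tendsto (fun k => B (X k) i j) l (𝓝 (B x i j)) := ((hB.1 i j).1.tendsto x).comp hX
  exact hb.mul (h1 j)

lemma lhs_lim (hgL : GoodData g L) (hB : GoodCoupling B) {ι : Type*} {l : Filter ι}
    {lam : ι → ℝ} {l0 : ℝ} (hlam : Tendsto lam l (𝓝 l0)) {u : ι → Fin m → Euc n → ℝ}
    {u0 : Fin m → Euc n → ℝ} (hu : ∀ i, TendstoUniformly (fun k => u k i) (u0 i) l)
    (hc0 : ∀ i, Continuous (u0 i)) {X : ι → Euc n} {x : Euc n} (hX : Tendsto X l (𝓝 x))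
    {p : Euc n → Euc n} (hp : Continuous p) (i : Fin m) :
    Tendsto (fun k => lhs B (lam k) g L (u k) i (X k) (p (X k))) l
      (𝓝 (lhs B l0 g L u0 i x (p x))) := by
  have h1 : ∀ j, Tendsto (fun k => u k j (X k)) l (𝓝 (u0 j x)) := fun j =>
    TendstoUniformly.tendsto_comp (hu j) (hc0 j).continuousAt hX
  have h5 := ((hlam.mul (h1 i)).add (lim2 hB hX h1 i)).add (lim1 hgL hX hp i)
  exact h5

lemma stab (hgL : GoodData g L) (hB : GoodCoupling B) {ι : Type*} {l : Filter ι} [l.NeBot]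
    {lam : ι → ℝ} {l0 : ℝ} (hlam : Tendsto lam l (𝓝 l0)) {u : ι → Fin m → Euc n → ℝ}
    {u0 : Fin m → Euc n → ℝ} (hu : ∀ i, TendstoUniformly (fun k => u k i) (u0 i) l)
    (hc0 : ∀ i, Continuous (u0 i)) (ht0 : ∀ i, TorusFun (u0 i))
    (hsol : ∀ᶠ k in l, IsSol B (lam k) g L (fun _ => 0) (u k)) :
    IsSol B l0 g L (fun _ => 0) u0 := by
  refine ⟨hc0, ⟨fun i => ⟨(hc0 i).upperSemicontinuous, ht0 i⟩, ?_⟩,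
    ⟨fun i => ⟨(hc0 i).lowerSemicontinuous, ht0 i⟩, ?_⟩⟩
  · intro i ψ hψ hψt x hx
    obtain ⟨X, hX, hXm⟩ := stab_core (hu i) (hc0 i) (hsol.mono fun k hk => hk.1 i) hψ.continuous hx
    have hlim := lhs_lim hgL hB hlam hu hc0 hX (grad_cont (pert_contDiff hψ 1 x)) i
    rw [grad_pert hψ] at hlim
    refine le_of_tendsto hlim ?_
    filter_upwards [hsol, hXm] with k hk hkm
    have hkm' : IsLocalMax (fun y => u k i y - (ψ y + 1 * Phi (y - x))) (X k) := by
      simpa only [one_mul] using hkm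
    exact hk.2.1.2 i _ (pert_contDiff hψ 1 x) (pert_torus hψt 1 x) (X k) hkm'
  · intro i ψ hψ hψt x hx
    have hu' : TendstoUniformly (fun k y => -u k i y) (fun y => -u0 i y) l := by
      have := hu i
      rw [Metric.tendstoUniformly_iff] at this ⊢
      simpa using this
    obtain ⟨X, hX, hXm⟩ := stab_core hu' (hc0 i).neg (hsol.mono fun k hk => (hk.1 i).neg)
      hψ.continuous.neg (x := x) (by
        filter_upwards [hx] with y hy
        simp only [Pi.neg_apply]
        linarith)
    have hlim := lhs_lim hgL hB hlam hu hc0 hX (grad_cont (pert_contDiff hψ (-1) x)) i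
    rw [grad_pert hψ] at hlim
    refine ge_of_tendsto hlim ?_
    filter_upwards [hsol, hXm] with k hk hkm
    refine hk.2.2.2 i _ (pert_contDiff hψ (-1) x) (pert_torus hψt (-1) x) (X k) ?_
    filter_upwards [hkm] with y hy
    simp only [Pi.neg_apply] at hy
    linarith

lemma sol_bound (hgL : GoodData g L) (hcoer : Coercive g L) (hB : GoodCoupling B) (hm : 0 < m)
    {v0 : Fin m → Euc n → ℝ} (h0 : IsSol B 0 g L (fun _ => 0) v0) {C : ℝ} (hC : ∀ i x, |v0 i x| ≤ C)
    {lam : ℝ} (hlam : 0 < lam) {v : Fin m → Euc n → ℝ} (hv : IsSol B lam g L (fun _ => 0) v) :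
    ∀ i x, |v i x| ≤ 2 * C := by
  have hh : (0:ℝ) < 1/2 := by norm_num
  intro j y
  obtain ⟨i, x, hmax, hval⟩ := vcmp hgL hcoer hB hm h0.2.1 h0.1 h0.2.1 h0.1 hv.2.2 hv.1 hh hh (by norm_num)
  obtain ⟨i', x', hmax', hval'⟩ := vcmp hgL hcoer hB hm hv.2.1 hv.1 hv.2.1 hv.1 h0.2.2 h0.1 hh hh (by norm_num)
  have a0 := abs_le.1 (hC j y)
  have hC0 : 0 ≤ C := (abs_nonneg _).trans (hC j y)
  rw [abs_le]
  constructor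
  · have h1 := hmax j y
    have a1 := abs_le.1 (hC i x)
    rcases le_or_gt 0 (1/2 * v0 i x + 1/2 * v0 i x - v i x) with hp | hp
    · have h2 := hval hp
      have h3 : 0 ≤ v i x := by
        by_contra hcon
        push Not at hcon
        have := mul_neg_of_pos_of_neg hlam hcon
        linarith
      linarith
    · linarith
  · have h1 := hmax' j y
    have a1 := abs_le.1 (hC i' x')
    rcases le_or_gt 0 (1/2 * v i' x' + 1/2 * v i' x' - v0 i' x') with hp | hp
    · have h2 := hval' hp
      have h3 : v i' x' ≤ 0 := by
        by_contra hcon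
        push Not at hcon
        have := mul_pos hlam hcon
        linarith
      linarith
    · linarith

lemma main_ineq (hgL : GoodData g L) (hcoer : Coercive g L) (hB : GoodCoupling B) (hm : 0 < m)
    {w : Fin m → Euc n → ℝ} (hw : IsSol B 0 g L (fun _ => 0) w)
    {δ lam : ℝ} (hlam : 0 < lam) (hδ : lam < δ) {vδ v : Fin m → Euc n → ℝ}
    (hvδ : IsSol B δ g L (fun _ => 0) vδ) (hv : IsSol B lam g L (fun _ => 0) v)
    {ε : ℝ} (hε : 0 < ε) (hclose : ∀ i x, |w i x - vδ i x| ≤ ε) (j : Fin m) (y : Euc n) :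
    (1 - lam / δ) * w j y + lam / δ * vδ j y - v j y ≤ ε := by
  have hδ0 : 0 < δ := hlam.trans hδ
  have ht : 0 < lam / δ := div_pos hlam hδ0
  have ht1 : lam / δ < 1 := (div_lt_one hδ0).2 hδ
  obtain ⟨i, x, hmax, hval⟩ := vcmp hgL hcoer hB hm hw.2.1 hw.1 hvδ.2.1 hvδ.1 hv.2.2 hv.1
    (s := 1 - lam / δ) (t := lam / δ) (by linarith) ht (by ring)
  refine (hmax j y).trans ?_
  rcases le_or_gt 0 ((1 - lam / δ) * w i x + lam / δ * vδ i x - v i x) with hp | hp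
  · have h2 := hval hp
    have e : lam / δ * (δ * vδ i x) = lam * vδ i x := by field_simp
    rw [e, zero_mul, mul_zero, zero_add] at h2
    have h3 := le_of_mul_le_mul_left h2 hlam
    have h4 := (abs_le.1 (hclose i x)).2
    have h5 : (1 - lam / δ) * (w i x - vδ i x) ≤ (1 - lam / δ) * ε :=
      mul_le_mul_of_nonneg_left h4 (by linarith)
    have h6 : (1 - lam / δ) * ε ≤ ε := by nlinarith
    linarith
  · linarith

end aux

theorem stmt13 {n m : ℕ} (hn : 0 < n) (hm : 0 < m)
    {Ξ : Type*} [MetricSpace Ξ] [CompactSpace Ξ] [Nonempty Ξ]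
    (g : Fin m → Euc n × Ξ → Euc n) (L : Fin m → Euc n × Ξ → ℝ)
    (hgL : GoodData g L) (hcoer : Coercive g L)
    (B : Euc n → Matrix (Fin m) (Fin m) ℝ) (hB : GoodCoupling B)
    (hE : AssumptionE B g L)
    (v : ℝ → Fin m → Euc n → ℝ)
    (hv : ∀ lam : ℝ, 0 < lam → IsSol B lam g L (fun _ => 0) (v lam)) :
    ∃ v0 : Fin m → Euc n → ℝ, IsSol B 0 g L (fun _ => 0) v0 ∧
      ∀ i, TendstoUniformly (fun lam => v lam i) (v0 i) (nhdsWithin 0 (Set.Ioi (0:ℝ))) := by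
  obtain ⟨v₀, -, hv₀⟩ := hE
  obtain ⟨C₀, hC₀⟩ := torus_bdd' (fun i => (hv₀.2.1.1 i).2) hv₀.1
  have hbd : ∀ lam : ℝ, 0 < lam → ∀ i x, |v lam i x| ≤ 2 * C₀ := fun lam hlam =>
    sol_bound hgL hcoer hB hm hv₀ hC₀ hlam (hv lam hlam)
  set C := 2 * C₀ with hCdef
  obtain ⟨R, hR⟩ := p_bound hcoer hB 1 C
  set K := (2 * |R| + 8 * C + 1) * Real.pi with hKdef
  have hlip : ∀ lam : ℝ, 0 < lam → lam ≤ 1 → ∀ i x y, v lam i y - v lam i x ≤ K * ‖y - x‖ := by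
    intro lam hlam hlam1 i x y
    have hs := hv lam hlam
    refine equi_lip (abs_nonneg R) (hs.1 i) (hs.2.1.1 i).2 (hbd lam hlam i) ?_ x y
    intro ψ hψ hψt a ha
    refine (hR lam (by rw [abs_of_pos hlam]; exact hlam1) (v lam) (hbd lam hlam) i a _ ?_).trans
      (le_abs_self R)
    exact hs.2.1.2 i ψ hψ hψt a ha
  let S : Set (Fin m → Euc n → ℝ) := {f | (∀ i x, f i x ∈ Set.Icc (-C) C) ∧
    (∀ i x z, IsIntVec z → f i (x + z) = f i x) ∧ ∀ i x y, f i y - f i x ≤ K * ‖y - x‖}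
  have hScomp : IsCompact S := by
    have hbig : IsCompact (Set.univ.pi fun _ : Fin m => Set.univ.pi fun _ : Euc n => Set.Icc (-C) C) :=
      isCompact_univ_pi fun _ => isCompact_univ_pi fun _ => isCompact_Icc
    refine hbig.of_isClosed_subset ?_ fun f hf i _ x _ => hf.1 i x
    have hev : ∀ (i : Fin m) (x : Euc n), Continuous fun f : Fin m → Euc n → ℝ => f i x := fun i x =>
      (continuous_apply x).comp (continuous_apply i)
    have e : S = (⋂ i, ⋂ x, {f | f i x ∈ Set.Icc (-C) C}) ∩
      ((⋂ i, ⋂ x, ⋂ z, ⋂ (_ : IsIntVec z), {f | f i (x + z) = f i x}) ∩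
        (⋂ i, ⋂ x, ⋂ y, {f | f i y - f i x ≤ K * ‖y - x‖})) := by
      ext f; simp [S]
    rw [e]
    refine IsClosed.inter ?_ (IsClosed.inter ?_ ?_)
    · exact isClosed_iInter fun i => isClosed_iInter fun x => isClosed_Icc.preimage (hev i x)
    · exact isClosed_iInter fun i => isClosed_iInter fun x => isClosed_iInter fun z =>
        isClosed_iInter fun _ => isClosed_eq (hev i _) (hev i x)
    · exact isClosed_iInter fun i => isClosed_iInter fun x => isClosed_iInter fun y =>
        isClosed_le ((hev i y).sub (hev i x)) continuous_const
  have hpos : ∀ᶠ lam in 𝓝[>] (0:ℝ), 0 < lam := self_mem_nhdsWithin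
  have hlt : ∀ δ : ℝ, 0 < δ → ∀ᶠ lam in 𝓝[>] (0:ℝ), lam < δ := fun δ hδ =>
    mem_nhdsWithin_of_mem_nhds (Iio_mem_nhds hδ)
  have hmem : ∀ᶠ lam in 𝓝[>] (0:ℝ), v lam ∈ S := by
    filter_upwards [hpos, hlt 1 one_pos] with lam h1 h2
    exact ⟨fun i x => abs_le.1 (hbd lam h1 i x), fun i x z hz => ((hv lam h1).2.1.1 i).2 x z hz,
      hlip lam h1 h2.le⟩
  have hid : Tendsto (fun lam : ℝ => lam) (𝓝[>] (0:ℝ)) (𝓝 0) := tendsto_id.mono_left nhdsWithin_le_nhds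
  have hconv : ∀ (l : Filter ℝ) (w : Fin m → Euc n → ℝ), l.NeBot → l ≤ 𝓝[>] (0:ℝ) → w ∈ S →
      Tendsto v l (𝓝 w) → (∀ i, TendstoUniformly (fun lam => v lam i) (w i) l) ∧
        IsSol B 0 g L (fun _ => 0) w := by
    intro l w hl hle hw hlim
    have hpt : ∀ i x, Tendsto (fun lam => v lam i x) l (𝓝 (w i x)) := fun i x =>
      tendsto_pi_nhds.1 (tendsto_pi_nhds.1 hlim i) x
    have hunif : ∀ i, TendstoUniformly (fun lam => v lam i) (w i) l := fun i => by
      refine unif_of_ptwise (K := K) ?_ (hw.2.1 i) (hw.2.2 i) (hpt i)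
      filter_upwards [hle hmem] with lam h
      exact ⟨h.2.1 i, h.2.2 i⟩
    refine ⟨hunif, stab hgL hB (hid.mono_left hle) hunif (fun i => ?_) (fun i => hw.2.1 i) ?_⟩
    · refine (hunif i).continuous (Eventually.frequently ?_)
      filter_upwards [hle hpos] with lam h
      exact (hv lam h).1 i
    · filter_upwards [hle hpos] with lam h
      exact hv lam h
  have hcmp : ∀ w w' : Fin m → Euc n → ℝ, w ∈ S → w' ∈ S → MapClusterPt w (𝓝[>] (0:ℝ)) v →
      MapClusterPt w' (𝓝[>] (0:ℝ)) v → ∀ j y, w j y ≤ w' j y := by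
    intro w w' hw hw' hcl hcl' j y
    obtain ⟨U, hU, hlim⟩ := mapClusterPt_iff_ultrafilter.1 hcl
    obtain ⟨U', hU', hlim'⟩ := mapClusterPt_iff_ultrafilter.1 hcl'
    obtain ⟨hunif, hsol⟩ := hconv U w U.neBot hU hw hlim
    refine le_of_forall_pos_le_add fun ε hε => ?_
    have hclose : ∀ᶠ δ in (U : Filter ℝ), ∀ i, ∀ x, dist (w i x) (v δ i x) < ε := by
      rw [eventually_all]
      intro i
      exact Metric.tendstoUniformly_iff.1 (hunif i) ε hε
    obtain ⟨δ, hδc, hδ⟩ := (hclose.and (hU hpos)).exists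
    have hineq : ∀ᶠ lam in (U' : Filter ℝ),
        (1 - lam / δ) * w j y + lam / δ * v δ j y - v lam j y ≤ ε := by
      filter_upwards [hU' hpos, hU' (hlt δ hδ)] with lam h1 h2
      exact main_ineq hgL hcoer hB hm hsol h1 h2 (hv δ hδ) (hv lam h1) hε
        (fun i x => by rw [← Real.dist_eq]; exact (hδc i x).le) j y
    have l1 : Tendsto (fun lam : ℝ => lam / δ) U' (𝓝 (0 / δ)) := (hid.mono_left hU').div_const δ
    rw [zero_div] at l1
    have l2 : Tendsto (fun lam => v lam j y) U' (𝓝 (w' j y)) :=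
      tendsto_pi_nhds.1 (tendsto_pi_nhds.1 hlim' j) y
    have l3 := (((tendsto_const_nhds (x := (1:ℝ))).sub l1).mul_const (w j y)).add (l1.mul_const (v δ j y))
    have l4 := le_of_tendsto (l3.sub l2) hineq
    linarith
  obtain ⟨w, hw, hcl⟩ := hScomp.exists_mapClusterPt (f := 𝓝[>] (0:ℝ)) (u := v)
    (le_principal_iff.2 hmem)
  have htend : Tendsto v (𝓝[>] (0:ℝ)) (𝓝 w) := by
    refine hScomp.tendsto_nhds_of_unique_mapClusterPt hmem fun w' hw' hcl' => ?_
    ext j y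
    exact le_antisymm (hcmp w' w hw' hw hcl' hcl j y) (hcmp w w' hw hw' hcl hcl' j y)
  obtain ⟨h1, h2⟩ := hconv _ w inferInstance le_rfl hw htend
  exact ⟨w, h2, h1⟩
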